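/- Let H₁, H₂ be n×n Hermitian matrices with H₁ > 0 and H₁ + H₂ > 0, and let f(t) = cosh(t) − 1. Then ∫₀^∞ ln det( I + (f(t)I + H₁)^{−1} H₂ ) dt = (1/2) tr[ arcosh²(H₁ + H₂ − I) − arcosh²(H₁ − I) ]. -/

import Mathlib

open Matrix
open scoped ComplexOrder

/-- `arcosh²` as a real-valued function: for `x ≥ 1` it is `(arcosh x)²`, and for `x < 1`
(principal branch, `arcosh x = ± i arccos x`) it is `−(arccos x)²`. -/
noncomputable def acoshSq (x : ℝ) : ℝ :=
  if 1 ≤ x then (Real.log (x + Real.sqrt (x ^ 2 - 1))) ^ 2 else -(Real.arccos x ^ 2)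

open MeasureTheory Filter Topology

lemma cosh_add_pos {b : ℝ} (hb : -1 < b) (t : ℝ) : 0 < Real.cosh t + b := by
  linarith [Real.one_le_cosh t]

lemma continuous_inv_cosh_add {b : ℝ} (hb : -1 < b) :
    Continuous fun t => (Real.cosh t + b)⁻¹ :=
  (Real.continuous_cosh.add continuous_const).inv₀ fun t => (cosh_add_pos hb t).ne'

lemma integrableOn_inv_cosh_add {b : ℝ} (hb : -1 < b) :
    IntegrableOn (fun t => (Real.cosh t + b)⁻¹) (Set.Ioi 0) := by
  have hk : 0 < min 1 (1 + b) := lt_min one_pos (by linarith)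
  refine ((integrableOn_exp_neg_Ioi 0).const_mul (2 / min 1 (1 + b))).mono'
    (continuous_inv_cosh_add hb).aestronglyMeasurable (ae_of_all _ fun t => ?_)
  have hpos := cosh_add_pos hb t
  rw [Real.norm_of_nonneg (inv_nonneg.2 hpos.le), inv_le_iff_one_le_mul₀ hpos]
  have hle : min 1 (1 + b) * Real.cosh t ≤ Real.cosh t + b := by
    have h1 := Real.one_le_cosh t
    rcases min_cases 1 (1 + b) with ⟨h, h'⟩ | ⟨h, h'⟩ <;> rw [h] <;> nlinarith
  have hexp : Real.exp t ≤ 2 * Real.cosh t := by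
    rw [Real.cosh_eq]
    linarith [Real.exp_pos (-t)]
  calc (1 : ℝ) = 1 / min 1 (1 + b) * min 1 (1 + b) * (Real.exp (-t) * Real.exp t) := by
        rw [← Real.exp_add]
        field_simp
        simp
    _ ≤ 1 / min 1 (1 + b) * min 1 (1 + b) * (Real.exp (-t) * (2 * Real.cosh t)) := by gcongr
    _ = 2 / min 1 (1 + b) * Real.exp (-t) * (min 1 (1 + b) * Real.cosh t) := by ring
    _ ≤ _ := by gcongr

lemma integral_inv_cosh_add_cos {θ : ℝ} (h0 : 0 < θ) (hπ : θ < Real.pi) :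
    ∫ t in Set.Ioi (0 : ℝ), Real.sin θ * (Real.cosh t + Real.cos θ)⁻¹ = θ := by
  have hs : 0 < Real.sin θ := Real.sin_pos_of_pos_of_lt_pi h0 hπ
  have hc : -1 < Real.cos θ := by
    rw [← Real.cos_pi]
    exact Real.cos_lt_cos_of_nonneg_of_le_pi h0.le le_rfl hπ
  have hderiv : ∀ t ∈ Set.Ici (0 : ℝ),
      HasDerivAt (fun t => 2 * Real.arctan ((Real.exp t + Real.cos θ) / Real.sin θ))
        (Real.sin θ * (Real.cosh t + Real.cos θ)⁻¹) t := by
    intro t _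
    refine ((((Real.hasDerivAt_exp t).add_const (Real.cos θ)).div_const
      (Real.sin θ)).arctan.const_mul 2).congr_deriv ?_
    have hpos := cosh_add_pos hc t
    have hsq := Real.sin_sq_add_cos_sq θ
    have hexp := Real.exp_pos t
    have key : Real.sin θ ^ 2 + (Real.exp t + Real.cos θ) ^ 2
        = 2 * Real.exp t * (Real.cosh t + Real.cos θ) := by
      have : Real.exp t * Real.exp (-t) = 1 := by rw [← Real.exp_add]; simp
      rw [Real.cosh_eq]
      linear_combination hsq - this
    have : 1 + ((Real.exp t + Real.cos θ) / Real.sin θ) ^ 2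
        = 2 * Real.exp t * (Real.cosh t + Real.cos θ) / Real.sin θ ^ 2 := by
      rw [← key]
      field_simp
    rw [this]
    field_simp
  have hlim : Tendsto (fun t => 2 * Real.arctan ((Real.exp t + Real.cos θ) / Real.sin θ)) atTop
      (𝓝 (2 * (Real.pi / 2))) :=
    ((Real.tendsto_arctan_atTop.mono_right nhdsWithin_le_nhds).comp
      ((tendsto_atTop_add_const_right _ _ Real.tendsto_exp_atTop).atTop_div_const hs)).const_mul 2
  rw [integral_Ioi_of_hasDerivAt_of_tendsto' hderiv
    ((integrableOn_inv_cosh_add hc).const_mul _) hlim]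
  have harg : (Real.exp 0 + Real.cos θ) / Real.sin θ = Real.tan (Real.pi / 2 - θ / 2) := by
    have hs2 : 0 < Real.sin (θ / 2) :=
      Real.sin_pos_of_pos_of_lt_pi (by linarith) (by linarith)
    have hc2 : 0 < Real.cos (θ / 2) := Real.cos_pos_of_mem_Ioo ⟨by linarith, by linarith⟩
    have h1 : Real.cos θ = 2 * Real.cos (θ / 2) ^ 2 - 1 := by
      rw [← Real.cos_two_mul]; ring_nf
    have h2 : Real.sin θ = 2 * Real.sin (θ / 2) * Real.cos (θ / 2) := by
      rw [← Real.sin_two_mul]; ring_nf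
    rw [Real.tan_pi_div_two_sub, Real.tan_eq_sin_div_cos, h1, h2, Real.exp_zero]
    field_simp
    ring
  rw [harg, Real.arctan_tan (by linarith) (by linarith)]
  ring

lemma integral_inv_cosh_add_cosh (s : ℝ) :
    ∫ t in Set.Ioi (0 : ℝ), Real.sinh s * (Real.cosh t + Real.cosh s)⁻¹ = s := by
  have hc : -1 < Real.cosh s := by linarith [Real.cosh_pos s]
  have hderiv : ∀ t ∈ Set.Ici (0 : ℝ),
      HasDerivAt (fun t => Real.log ((Real.exp t + Real.exp (-s)) / (Real.exp t + Real.exp s)))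
        (Real.sinh s * (Real.cosh t + Real.cosh s)⁻¹) t := by
    intro t _
    have h1 : 0 < Real.exp t + Real.exp (-s) := by positivity
    have h2 : 0 < Real.exp t + Real.exp s := by positivity
    refine ((((Real.hasDerivAt_exp t).add_const (Real.exp (-s))).div
      ((Real.hasDerivAt_exp t).add_const (Real.exp s)) h2.ne').log
      (div_pos h1 h2).ne').congr_deriv ?_
    have hpos := cosh_add_pos hc t
    have key : (Real.exp t + Real.exp (-s)) * (Real.exp t + Real.exp s)
        = 2 * Real.exp t * (Real.cosh t + Real.cosh s) := by
      have ht : Real.exp t * Real.exp (-t) = 1 := by rw [← Real.exp_add]; simp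
      have hs : Real.exp s * Real.exp (-s) = 1 := by rw [← Real.exp_add]; simp
      rw [Real.cosh_eq, Real.cosh_eq]
      linear_combination hs - ht
    rw [← div_eq_mul_inv, eq_div_iff hpos.ne', Real.sinh_eq]
    have hexp := Real.exp_pos t
    have : Real.cosh t + Real.cosh s
        = (Real.exp t + Real.exp (-s)) * (Real.exp t + Real.exp s) / (2 * Real.exp t) := by
      rw [key]
      field_simp
    rw [this, Pi.div_apply]
    field_simp
    ring
  have hlim : Tendsto
      (fun t => Real.log ((Real.exp t + Real.exp (-s)) / (Real.exp t + Real.exp s))) atTop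
      (𝓝 0) := by
    rw [← Real.log_one]
    refine Tendsto.log ?_ one_ne_zero
    have h : Tendsto (fun t => 1 + (Real.exp (-s) - Real.exp s) / (Real.exp t + Real.exp s))
        atTop (𝓝 (1 + 0)) :=
      (Tendsto.div_atTop tendsto_const_nhds
        (tendsto_atTop_add_const_right _ _ Real.tendsto_exp_atTop)).const_add 1
    rw [add_zero] at h
    refine h.congr fun t => ?_
    have h2 : 0 < Real.exp t + Real.exp s := by positivity
    field_simp
    ring
  rw [integral_Ioi_of_hasDerivAt_of_tendsto' hderiv
    ((integrableOn_inv_cosh_add hc).const_mul _) hlim]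
  have : (Real.exp 0 + Real.exp (-s)) / (Real.exp 0 + Real.exp s) = Real.exp (-s) := by
    have h2 : 0 < 1 + Real.exp s := by positivity
    have hs : Real.exp (-s) * Real.exp s = 1 := by rw [← Real.exp_add]; simp
    rw [Real.exp_zero, div_eq_iff h2.ne']
    linear_combination -hs
  rw [this, Real.log_exp]
  ring

/-- The logarithm of `cosh t + b`, renormalized so as to be integrable on `(0, ∞)`. -/
noncomputable def logCoshAdd (b t : ℝ) : ℝ :=
  Real.log (Real.cosh t + b) - Real.log (Real.cosh t + 1)

lemma continuous_logCoshAdd {b : ℝ} (hb : -1 < b) : Continuous (logCoshAdd b) :=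
  ((Real.continuous_cosh.add continuous_const).log fun t => (cosh_add_pos hb t).ne').sub
    ((Real.continuous_cosh.add continuous_const).log fun t =>
      (cosh_add_pos (by norm_num) t).ne')

lemma integrableOn_logCoshAdd {b : ℝ} (hb : -1 < b) :
    IntegrableOn (logCoshAdd b) (Set.Ioi 0) := by
  refine (((integrableOn_inv_cosh_add (b := 1) (by norm_num)).add
    (integrableOn_inv_cosh_add hb)).const_mul |b - 1|).mono'
    (continuous_logCoshAdd hb).aestronglyMeasurable (ae_of_all _ fun t => ?_)
  have h1 := cosh_add_pos (b := 1) (by norm_num) t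
  have h2 := cosh_add_pos hb t
  have hle : logCoshAdd b t ≤ (b - 1) * (Real.cosh t + 1)⁻¹ := by
    rw [logCoshAdd, ← Real.log_div h2.ne' h1.ne']
    refine (Real.log_le_sub_one_of_pos (div_pos h2 h1)).trans_eq ?_
    field_simp
    ring
  have hge : (b - 1) * (Real.cosh t + b)⁻¹ ≤ logCoshAdd b t := by
    rw [logCoshAdd, ← neg_sub (Real.log (Real.cosh t + 1)), ← Real.log_div h1.ne' h2.ne', le_neg]
    refine (Real.log_le_sub_one_of_pos (div_pos h1 h2)).trans_eq ?_
    field_simp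
    ring
  have hi1 := inv_pos.2 h1
  have hi2 := inv_pos.2 h2
  simp only [Pi.add_apply]
  rw [Real.norm_eq_abs, abs_le]
  constructor
  · nlinarith [neg_abs_le (b - 1), mul_nonneg (abs_nonneg (b - 1)) hi1.le]
  · nlinarith [le_abs_self (b - 1), mul_nonneg (abs_nonneg (b - 1)) hi2.le]

lemma hasDerivAt_integral_logCoshAdd {b : ℝ} (hb : -1 < b) :
    HasDerivAt (fun b => ∫ t in Set.Ioi (0 : ℝ), logCoshAdd b t)
      (∫ t in Set.Ioi (0 : ℝ), (Real.cosh t + b)⁻¹) b := by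
  obtain ⟨c, hc, hcb⟩ := exists_between hb
  refine (hasDerivAt_integral_of_dominated_loc_of_deriv_le (s := Set.Ioi c)
    (F' := fun b t => (Real.cosh t + b)⁻¹) (bound := fun t => (Real.cosh t + c)⁻¹)
    (Ioi_mem_nhds hcb) ?_ (integrableOn_logCoshAdd hb)
    (continuous_inv_cosh_add hb).aestronglyMeasurable ?_ (integrableOn_inv_cosh_add hc) ?_).2
  · filter_upwards [Ioi_mem_nhds hb] with x hx
    exact (continuous_logCoshAdd hx).aestronglyMeasurable
  · refine ae_of_all _ fun t x hx => ?_
    have hx : c < x := hx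
    have h1 := cosh_add_pos hc t
    have h2 := cosh_add_pos (hc.trans hx) t
    rw [Real.norm_of_nonneg (inv_nonneg.2 h2.le)]
    gcongr
  · refine ae_of_all _ fun t x hx => ?_
    have h2 := cosh_add_pos (hc.trans hx) t
    simpa [logCoshAdd] using
      (((hasDerivAt_id x).const_add (Real.cosh t)).log h2.ne').sub_const
        (Real.log (Real.cosh t + 1))

lemma integral_logCoshAdd_one : ∫ t in Set.Ioi (0 : ℝ), logCoshAdd 1 t = 0 := by
  simp [logCoshAdd]

lemma integral_logCoshAdd_cos {θ : ℝ} (h0 : 0 ≤ θ) (hπ : θ < Real.pi) :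
    ∫ t in Set.Ioi (0 : ℝ), logCoshAdd (Real.cos θ) t = -(θ ^ 2 / 2) := by
  have hd : ∀ x ∈ Set.Icc 0 θ, HasDerivAt
      (fun x => (∫ t in Set.Ioi (0 : ℝ), logCoshAdd (Real.cos x) t) + x ^ 2 / 2) 0 x := by
    intro x hx
    have hxπ : x < Real.pi := hx.2.trans_lt hπ
    have hc : -1 < Real.cos x := by
      rw [← Real.cos_pi]
      exact Real.cos_lt_cos_of_nonneg_of_le_pi hx.1 le_rfl hxπ
    have h := ((hasDerivAt_integral_logCoshAdd hc).comp x (Real.hasDerivAt_cos x)).add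
      ((hasDerivAt_pow 2 x).div_const 2)
    refine h.congr_deriv ?_
    rcases hx.1.eq_or_lt with rfl | hx0
    · simp
    · have := integral_inv_cosh_add_cos hx0 hxπ
      rw [integral_const_mul] at this
      push_cast
      linear_combination -this
  have := constant_of_has_deriv_right_zero
    (fun x hx => (hd x hx).continuousAt.continuousWithinAt)
    (fun x hx => (hd x (Set.Ico_subset_Icc_self hx)).hasDerivWithinAt) θ ⟨h0, le_rfl⟩
  simp only [Real.cos_zero, integral_logCoshAdd_one] at this
  linarith

lemma integral_logCoshAdd_cosh {s : ℝ} (h0 : 0 ≤ s) :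
    ∫ t in Set.Ioi (0 : ℝ), logCoshAdd (Real.cosh s) t = s ^ 2 / 2 := by
  have hd : ∀ x ∈ Set.Icc 0 s, HasDerivAt
      (fun x => (∫ t in Set.Ioi (0 : ℝ), logCoshAdd (Real.cosh x) t) - x ^ 2 / 2) 0 x := by
    intro x _
    have hc : -1 < Real.cosh x := by linarith [Real.cosh_pos x]
    have h := ((hasDerivAt_integral_logCoshAdd hc).comp x (Real.hasDerivAt_cosh x)).sub
      ((hasDerivAt_pow 2 x).div_const 2)
    refine h.congr_deriv ?_
    have := integral_inv_cosh_add_cosh x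
    rw [integral_const_mul] at this
    push_cast
    linear_combination this
  have := constant_of_has_deriv_right_zero
    (fun x hx => (hd x hx).continuousAt.continuousWithinAt)
    (fun x hx => (hd x (Set.Ico_subset_Icc_self hx)).hasDerivWithinAt) s ⟨h0, le_rfl⟩
  simp only [Real.cosh_zero, integral_logCoshAdd_one] at this
  linarith

lemma integral_logCoshAdd {b : ℝ} (hb : -1 < b) :
    ∫ t in Set.Ioi (0 : ℝ), logCoshAdd b t = 1 / 2 * acoshSq b := by
  unfold acoshSq
  split_ifs with h
  · have := integral_logCoshAdd_cosh (Real.arcosh_nonneg h)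
    rw [Real.cosh_arcosh h] at this
    rw [this, Real.arcosh]
    ring
  · push Not at h
    have := integral_logCoshAdd_cos (Real.arccos_nonneg b)
      (lt_of_le_of_ne (Real.arccos_le_pi b) fun he => by
        linarith [Real.arccos_eq_pi.1 he])
    rw [Real.cos_arccos hb.le h.le] at this
    rw [this]
    ring

lemma Matrix.IsHermitian.det_smul_one_add {n : Type*} [Fintype n] [DecidableEq n]
    {A : Matrix n n ℂ} (hA : A.IsHermitian) (c : ℝ) :
    ((c : ℂ) • (1 : Matrix n n ℂ) + A).det = ((∏ i, (c + hA.eigenvalues i) : ℝ) : ℂ) := by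
  have h := congrArg (Polynomial.eval (-(c : ℂ))) hA.charpoly_eq
  rw [Matrix.eval_charpoly, Polynomial.eval_prod] at h
  have h1 : Matrix.scalar n (-(c : ℂ)) - A = -((c : ℂ) • (1 : Matrix n n ℂ) + A) := by
    rw [Matrix.scalar_apply, ← Matrix.smul_one_eq_diagonal]
    module
  have h2 : ∀ i, Polynomial.eval (-(c : ℂ))
      (Polynomial.X - Polynomial.C (hA.eigenvalues i : ℂ))
      = -1 * ((c : ℂ) + hA.eigenvalues i) := fun i => by simp; ring
  rw [h1, Matrix.det_neg] at h
  simp only [RCLike.ofReal_eq_complex_ofReal, h2] at h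
  rw [Finset.prod_mul_distrib, Finset.prod_const, Finset.card_univ] at h
  push_cast
  exact mul_left_cancel₀ (pow_ne_zero _ (by norm_num)) h

lemma Matrix.PosDef.neg_one_lt_eigenvalues_sub_one {n : Type*} [Fintype n] [DecidableEq n]
    {A : Matrix n n ℂ} (hA : A.PosDef) (h : (A - 1).IsHermitian) (i : n) :
    -1 < h.eigenvalues i := by
  have hi := h.eigenvalues_mem_spectrum_real i
  have hmem : h.eigenvalues i + 1 ∈ spectrum ℝ A := by
    rw [spectrum.mem_iff] at hi ⊢
    convert hi using 2
    rw [map_add, map_one]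
    abel
  rw [hA.1.spectrum_real_eq_range_eigenvalues] at hmem
  obtain ⟨j, hj⟩ := hmem
  linarith [hA.eigenvalues_pos j]

/-- For Hermitian `n×n` matrices `H₁, H₂` with `H₁ > 0` and `H₁ + H₂ > 0`,
and `f(t) = cosh t − 1`:
`∫₀^∞ ln det(I + (f(t)I + H₁)⁻¹ H₂) dt = ½ tr[arcosh²(H₁+H₂−I) − arcosh²(H₁−I)]`,
the traces being computed as sums of `arcosh²` of the eigenvalues. -/
theorem stmt10 {n : ℕ} (H₁ H₂ : Matrix (Fin n) (Fin n) ℂ)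
    (hH1 : H₁.PosDef) (hH2 : H₂.IsHermitian) (hH12 : (H₁ + H₂).PosDef)
    (hA : (H₁ - 1).IsHermitian) (hAB : (H₁ + H₂ - 1).IsHermitian) :
    (∫ t in Set.Ioi (0 : ℝ),
        Real.log ((1 + (((Real.cosh t - 1 : ℝ) : ℂ) • (1 : Matrix (Fin n) (Fin n) ℂ) + H₁)⁻¹
          * H₂).det.re))
      = (1 / 2) * ((∑ i, acoshSq (hAB.eigenvalues i)) - ∑ i, acoshSq (hA.eigenvalues i)) := by
  have hl := hH1.neg_one_lt_eigenvalues_sub_one hA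
  have hm := hH12.neg_one_lt_eigenvalues_sub_one hAB
  have hlog : ∀ t : ℝ, Real.log ((1 + (((Real.cosh t - 1 : ℝ) : ℂ) •
      (1 : Matrix (Fin n) (Fin n) ℂ) + H₁)⁻¹ * H₂).det.re)
      = ∑ i, logCoshAdd (hAB.eigenvalues i) t - ∑ i, logCoshAdd (hA.eigenvalues i) t := by
    intro t
    have hpl : ∀ i, Real.cosh t + hA.eigenvalues i ≠ 0 := fun i => (cosh_add_pos (hl i) t).ne'
    have hpm : ∀ i, Real.cosh t + hAB.eigenvalues i ≠ 0 := fun i => (cosh_add_pos (hm i) t).ne'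
    set B := ((Real.cosh t - 1 : ℝ) : ℂ) • (1 : Matrix (Fin n) (Fin n) ℂ) + H₁ with hB
    have hBeq : B = (Real.cosh t : ℂ) • (1 : Matrix (Fin n) (Fin n) ℂ) + (H₁ - 1) := by
      rw [hB, Complex.ofReal_sub, Complex.ofReal_one]
      module
    have hBdet : B.det = ((∏ i, (Real.cosh t + hA.eigenvalues i) : ℝ) : ℂ) := by
      rw [hBeq, hA.det_smul_one_add]
    have hB2det : (B + H₂).det = ((∏ i, (Real.cosh t + hAB.eigenvalues i) : ℝ) : ℂ) := by
      rw [← hAB.det_smul_one_add, hBeq]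
      congr 1
      abel
    have hunit : IsUnit B.det := by
      rw [hBdet, isUnit_iff_ne_zero, Complex.ofReal_ne_zero]
      exact Finset.prod_ne_zero_iff.2 fun i _ => hpl i
    have hmul : 1 + B⁻¹ * H₂ = B⁻¹ * (B + H₂) := by
      rw [mul_add, Matrix.nonsing_inv_mul _ hunit]
    rw [hmul, Matrix.det_mul, Matrix.det_nonsing_inv, Ring.inverse_eq_inv', hBdet, hB2det,
      ← Complex.ofReal_inv, ← Complex.ofReal_mul, Complex.ofReal_re,
      Real.log_mul (inv_ne_zero (Finset.prod_ne_zero_iff.2 fun i _ => hpl i))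
        (Finset.prod_ne_zero_iff.2 fun i _ => hpm i), Real.log_inv,
      Real.log_prod fun i _ => hpl i, Real.log_prod fun i _ => hpm i]
    simp only [logCoshAdd, Finset.sum_sub_distrib]
    ring
  simp only [hlog]
  rw [integral_sub (integrable_finsetSum _ fun i _ => integrableOn_logCoshAdd (hm i))
      (integrable_finsetSum _ fun i _ => integrableOn_logCoshAdd (hl i)),
    integral_finsetSum _ fun i _ => integrableOn_logCoshAdd (hm i),
    integral_finsetSum _ fun i _ => integrableOn_logCoshAdd (hl i)]
  simp only [fun i => integral_logCoshAdd (hm i), fun i => integral_logCoshAdd (hl i),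
    ← Finset.mul_sum]
  ring
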